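/- Let K be an algebraically closed field of characteristic 0, let n ≤ 3, and let G ∈ K[x₀,…,x_n] be homogeneous of degree d ≥ 2 whose first partial derivatives are linearly independent over K. Then there exist k₀,…,k_n ∈ K such that, setting L = Σᵢ kᵢ ∂/∂xᵢ, for every operator y = Σᵢ cᵢ ∂/∂xᵢ (cᵢ ∈ K) the vanishing (L^{d−2}·y)(G) = 0 implies y(G) = 0. -/

import Mathlib

namespace GordanNoether

open MvPolynomial

section Derivations

variable {K : Type*} [CommRing K] {σ ι : Type*}

theorem derivation_aeval {A : Type*} [CommRing A] [Algebra K A] [Fintype σ]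
    (D : Derivation K A A) (p : σ → A) (f : MvPolynomial σ K) :
    D (aeval p f) = ∑ j, aeval p (pderiv j f) * D (p j) := by
  classical
  induction f using MvPolynomial.induction_on with
  | C a => simp
  | add f g hf hg => simp [hf, hg, add_mul, Finset.sum_add_distrib]
  | mul_X f i hf =>
    simp only [map_mul, aeval_X, Derivation.leibniz, hf, smul_eq_mul, map_add, pderiv_X, add_mul,
      Finset.sum_add_distrib, Finset.mul_sum]
    congr 1
    · rw [Finset.sum_eq_single i]
      · simp
      · intro j _ hj
        simp [hj.symm]
      · simp
    · exact Finset.sum_congr rfl fun j _ => by ring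

/-- Apply a derivation of the coefficient ring to each coefficient of a polynomial. -/
noncomputable def coeffDerivation {L : Type*} [CommRing L] [Algebra K L] (ι : Type*)
    (D : Derivation K L L) : Derivation K (MvPolynomial ι L) (MvPolynomial ι L) :=
  Derivation.mk'
    ((AddMonoidAlgebra.coeffLinearEquiv K).symm.toLinearMap ∘ₗ
      Finsupp.mapRange.linearMap (D : L →ₗ[K] L) ∘ₗ
      (AddMonoidAlgebra.coeffLinearEquiv K).toLinearMap) (by
    classical
    intro P Q
    have key : ∀ (P : MvPolynomial ι L) (m : ι →₀ ℕ), coeff m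
      (((AddMonoidAlgebra.coeffLinearEquiv K).symm.toLinearMap ∘ₗ
      Finsupp.mapRange.linearMap (D : L →ₗ[K] L) ∘ₗ
      (AddMonoidAlgebra.coeffLinearEquiv K).toLinearMap) P) = D (coeff m P) := fun _ _ => rfl
    ext m
    rw [key]
    simp only [smul_eq_mul, coeff_add, coeff_mul, key, map_sum, Derivation.leibniz,
      Finset.sum_add_distrib]
    congr 1
    rw [← Finset.sum_equiv (Equiv.prodComm _ _) (s := Finset.HasAntidiagonal.antidiagonal m)
      (g := fun q => coeff q.1 Q * D (coeff q.2 P)) (fun q => by simp [add_comm]) (fun q _ => rfl)]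
    rfl)

theorem coeff_coeffDerivation {L : Type*} [CommRing L] [Algebra K L]
    (D : Derivation K L L) (P : MvPolynomial ι L) (m : ι →₀ ℕ) :
    coeff m (coeffDerivation ι D P) = D (coeff m P) := rfl

theorem coeffDerivation_C {L : Type*} [CommRing L] [Algebra K L]
    (D : Derivation K L L) (a : L) : coeffDerivation ι D (C a) = C (D a) := by
  classical
  ext m
  rw [coeff_coeffDerivation, coeff_C, coeff_C]
  split_ifs <;> simp

theorem coeffDerivation_X {L : Type*} [CommRing L] [Algebra K L]
    (D : Derivation K L L) (a : ι) : coeffDerivation ι D (X a) = 0 := by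
  classical
  ext m
  rw [coeff_coeffDerivation, coeff_X]
  split_ifs <;> simp

theorem eq_C_of_pderiv_eq_coeffDerivation {L : Type*} [Field L] [CharZero L] [Algebra K L]
    (D : ι → Derivation K L L) (Q : MvPolynomial ι L)
    (hQ : ∀ a, pderiv a Q = coeffDerivation ι (D a) Q) (h0 : ∀ a, D a (coeff 0 Q) = 0) :
    Q = C (coeff 0 Q) := by
  classical
  have key : ∀ n : ℕ, ∀ m : ι →₀ ℕ, m.degree = n → m ≠ 0 → coeff m Q = 0 := by
    intro n
    induction n with
    | zero => intro m hm h; exact absurd ((Finsupp.degree_eq_zero_iff m).1 hm) h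
    | succ n ih =>
      intro m hm h
      obtain ⟨a, ha⟩ : ∃ a, m a ≠ 0 := by
        by_contra! hc
        exact h (Finsupp.ext hc)
      obtain ⟨k, rfl⟩ : ∃ k : ι →₀ ℕ, m = k + Finsupp.single a 1 := by
        refine ⟨m - Finsupp.single a 1, ?_⟩
        rw [tsub_add_cancel_of_le]
        simpa using Nat.one_le_iff_ne_zero.2 ha
      have h1 : D a (coeff k Q) = 0 := by
        by_cases hk : k = 0
        · rw [hk, h0]
        · rw [ih k (by simpa [map_add] using hm) hk, map_zero]
      have h2 := coeff_pderiv (i := a) Q k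
      rw [hQ, coeff_coeffDerivation, h1] at h2
      exact (mul_eq_zero.1 h2.symm).resolve_right (by exact_mod_cast Nat.succ_ne_zero (k a))
  ext m
  rw [coeff_C]
  split_ifs with h
  · rw [h]
  · exact key _ m rfl (Ne.symm h)

end Derivations

section Translation

variable {K L σ : Type*} [Field K] [Field L] [Algebra K L] [Fintype σ]

/-- The derivation `∑ j, u j • ∂ j`. -/
noncomputable def directional (pd : σ → Derivation K L L) (u : σ → L) : Derivation K L L :=
  ∑ j, u j • pd j

theorem directional_apply (pd : σ → Derivation K L L) (u : σ → L) (z : L) :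
    directional pd u z = ∑ j, u j * pd j z := by
  have h := congrFun (map_sum (Derivation.coeFnAddMonoidHom (R := K) (A := L) (M := L))
    (fun j => u j • pd j) Finset.univ) z
  rw [Finset.sum_apply] at h
  exact h

omit [Fintype σ] in
theorem ringHom_aeval {A B : Type*} [CommRing A] [CommRing B] [Algebra K A] [Algebra K B]
    (φ : A →+* B) (hφ : φ.comp (algebraMap K A) = algebraMap K B) (p : σ → A)
    (f : MvPolynomial σ K) : φ (aeval p f) = aeval (fun i => φ (p i)) f := by
  rw [map_aeval, hφ]
  rfl

variable [DecidableEq σ] {x : σ → L} {pd : σ → Derivation K L L}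

theorem directional_coord (hx : ∀ i j, pd i (x j) = if i = j then 1 else 0) (u : σ → L) (j : σ) :
    directional pd u (x j) = u j := by
  simp [directional_apply, hx]

theorem pd_aeval (hx : ∀ i j, pd i (x j) = if i = j then 1 else 0) (i : σ)
    (f : MvPolynomial σ K) : pd i (aeval x f) = aeval x (pderiv i f) := by
  simp [derivation_aeval, hx]

variable {ι : Type*} [Fintype ι]

/-- The generic translate `x + ∑ a, T a • u a` with indeterminate coefficients `T a`. -/
noncomputable def genericTranslate (x : σ → L) (u : ι → σ → L) (i : σ) : MvPolynomial ι L :=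
  C (x i) + ∑ a, X a * C (u a i)

omit [Fintype σ] [DecidableEq σ] in
theorem coeffDerivation_genericTranslate (D : Derivation K L L) (u : ι → σ → L) (i : σ) :
    coeffDerivation ι D (genericTranslate x u i) = C (D (x i)) + ∑ a, X a * C (D (u a i)) := by
  simp [genericTranslate, coeffDerivation_C, coeffDerivation_X, Derivation.leibniz]

omit [Fintype σ] [DecidableEq σ] in
theorem pderiv_genericTranslate (u : ι → σ → L) (a : ι) (i : σ) :
    pderiv a (genericTranslate x u i) = C (u a i) := by
  classical
  simp [genericTranslate, Derivation.leibniz, pderiv_X, Pi.single_apply]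

omit [Fintype σ] [DecidableEq σ] in
theorem coeff_zero_aeval_genericTranslate (u : ι → σ → L) (f : MvPolynomial σ K) :
    coeff 0 (aeval (genericTranslate x u) f) = aeval x f := by
  have := ringHom_aeval (K := K) (constantCoeff (σ := ι) (R := L)) (RingHom.ext fun a => by
      rw [RingHom.comp_apply, MvPolynomial.algebraMap_apply, constantCoeff_C])
    (genericTranslate x u) f
  rw [constantCoeff_eq] at this
  rw [this]
  congr 2
  ext i
  rw [← constantCoeff_eq]
  simp [genericTranslate]

theorem sum_aeval_genericTranslate [CharZero L]
    (hx : ∀ i j, pd i (x j) = if i = j then 1 else 0)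
    {u : ι → σ → L} (hu : ∀ a b i, directional pd (u a) (u b i) = 0)
    {τ : Type*} [Fintype τ] {c : τ → L} {g : τ → MvPolynomial σ K}
    (hc : ∀ a t, directional pd (u a) (c t) = 0)
    (hg : ∀ a, directional pd (u a) (∑ t, c t * aeval x (g t)) = 0) :
    ∑ t, C (c t) * aeval (genericTranslate x u) (g t) = C (∑ t, c t * aeval x (g t)) := by
  have h0 : coeff 0 (∑ t, C (c t) * aeval (genericTranslate x u) (g t)) =
      ∑ t, c t * aeval x (g t) := by
    simp [coeff_sum, coeff_C_mul, coeff_zero_aeval_genericTranslate]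
  rw [← h0]
  refine eq_C_of_pderiv_eq_coeffDerivation (fun a => directional pd (u a)) _ (fun a => ?_)
    (fun a => by rw [h0, hg])
  simp only [map_sum]
  refine Finset.sum_congr rfl fun t _ => ?_
  rw [pderiv_C_mul, Derivation.leibniz, coeffDerivation_C, hc]
  have h1 := derivation_aeval ((pderiv a : Derivation L (MvPolynomial ι L) _).restrictScalars K)
    (genericTranslate x u) (g t)
  rw [Derivation.restrictScalars_apply] at h1
  rw [h1, derivation_aeval]
  simp [coeffDerivation_genericTranslate, hu, directional_coord hx, pderiv_genericTranslate]

/-- Translation along directions whose coordinates are constants of the corresponding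
derivations: a combination which is a constant of these derivations is invariant. -/
theorem sum_aeval_translate [CharZero L] {E : Type*} [Field E] [Algebra K E] (φ : L →ₐ[K] E)
    (hx : ∀ i j, pd i (x j) = if i = j then 1 else 0)
    {u : ι → σ → L} (hu : ∀ a b i, directional pd (u a) (u b i) = 0)
    {τ : Type*} [Fintype τ] {c : τ → L} {g : τ → MvPolynomial σ K}
    (hc : ∀ a t, directional pd (u a) (c t) = 0)
    (hg : ∀ a, directional pd (u a) (∑ t, c t * aeval x (g t)) = 0) (α : ι → E) :
    ∑ t, φ (c t) * aeval (fun i => φ (x i) + ∑ a, α a * φ (u a i)) (g t) =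
      φ (∑ t, c t * aeval x (g t)) := by
  have h := congrArg (eval₂Hom (φ : L →+* E) α) (sum_aeval_genericTranslate hx hu hc hg)
  generalize ∑ t, c t * aeval x (g t) = z at h ⊢
  have hφ : (eval₂Hom (φ : L →+* E) α).comp (algebraMap K (MvPolynomial ι L)) =
      algebraMap K E := by
    refine RingHom.ext fun a => ?_
    rw [RingHom.comp_apply, MvPolynomial.algebraMap_apply, coe_eval₂Hom, eval₂_C]
    exact φ.commutes a
  rw [coe_eval₂Hom, eval₂_C, ← coe_eval₂Hom] at h
  simp only [map_sum, map_mul, ringHom_aeval _ hφ] at h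
  simpa [genericTranslate] using h

theorem aeval_translate [CharZero L] {E : Type*} [Field E] [Algebra K E] (φ : L →ₐ[K] E)
    (hx : ∀ i j, pd i (x j) = if i = j then 1 else 0)
    {u : ι → σ → L} (hu : ∀ a b i, directional pd (u a) (u b i) = 0) {f : MvPolynomial σ K}
    (hf : ∀ a, directional pd (u a) (aeval x f) = 0) (α : ι → E) :
    aeval (fun i => φ (x i) + ∑ a, α a * φ (u a i)) f = φ (aeval x f) := by
  simpa using sum_aeval_translate φ hx hu (τ := Unit) (c := fun _ => 1) (g := fun _ => f)
    (by simp) (by simpa using hf) α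

omit [DecidableEq σ] in
theorem aeval_smul_of_isHomogeneous {E : Type*} [Field E] [Algebra K E] {f : MvPolynomial σ K}
    {e : ℕ} (hf : f.IsHomogeneous e) (c : E) (p : σ → E) :
    aeval (fun i => c * p i) f = c ^ e * aeval p f := by
  rw [aeval_def, aeval_def, eval₂_eq', eval₂_eq', Finset.mul_sum]
  refine Finset.sum_congr rfl fun m hm => ?_
  have h := hf (mem_support_iff.1 hm)
  rw [Finsupp.weight_apply, Finsupp.sum_fintype _ _ (by simp)] at h
  simp only [Pi.one_apply, smul_eq_mul, mul_one] at h
  rw [← h]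
  simp only [mul_pow, Finset.prod_mul_distrib, Finset.prod_pow_eq_pow_sum]
  ring

omit [DecidableEq σ] in
theorem aeval_smul_add_of_isHomogeneous {E : Type*} [Field E] [Infinite E] [Algebra K E]
    {f : MvPolynomial σ K} {e : ℕ} (hf : f.IsHomogeneous e) (p w : σ → E)
    (h : ∀ t : E, aeval (fun i => p i + t * w i) f = aeval p f) (c : E) :
    aeval (fun i => c * p i + w i) f = c ^ e * aeval p f := by
  have hne : ∀ c : E, c ≠ 0 → aeval (fun i => c * p i + w i) f = c ^ e * aeval p f := by
    intro c hc
    rw [← h c⁻¹, ← aeval_smul_of_isHomogeneous hf]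
    congr 2
    ext i
    field_simp
  have hP : ∀ s : E, Polynomial.eval s (aeval
      (fun i => Polynomial.X * Polynomial.C (p i) + Polynomial.C (w i)) f) =
      aeval (fun i => s * p i + w i) f := by
    intro s
    have := ringHom_aeval (K := K) (Polynomial.evalRingHom s)
      (by ext a; simp [Polynomial.algebraMap_apply])
      (fun i => Polynomial.X * Polynomial.C (p i) + Polynomial.C (w i)) f
    rw [Polynomial.coe_evalRingHom] at this
    rw [this]
    simp only [Polynomial.eval_add, Polynomial.eval_mul, Polynomial.eval_X, Polynomial.eval_C]
  have hpoly : aeval (fun i => Polynomial.X * Polynomial.C (p i) + Polynomial.C (w i)) f =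
      Polynomial.X ^ e * Polynomial.C (aeval p f) := by
    refine Polynomial.eq_of_infinite_eval_eq _ _ (Set.Infinite.mono ?_
      (Set.Finite.infinite_compl (Set.finite_singleton (0 : E))))
    intro s hs
    rw [Set.mem_ofPred_eq, hP, hne s hs, Polynomial.eval_mul, Polynomial.eval_C,
      Polynomial.eval_pow, Polynomial.eval_X]
  rw [← hP, hpoly, Polynomial.eval_mul, Polynomial.eval_C, Polynomial.eval_pow, Polynomial.eval_X]

end Translation

section Hessian

variable {K L σ : Type*} [Field K] [Field L] [Algebra K L] [Fintype σ]

omit [Fintype σ] in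
theorem pderiv_comm (i j : σ) (f : MvPolynomial σ K) :
    pderiv i (pderiv j f) = pderiv j (pderiv i f) := by
  classical
  have h : ⁅(pderiv i : Derivation K (MvPolynomial σ K) (MvPolynomial σ K)),
      (pderiv j : Derivation K (MvPolynomial σ K) (MvPolynomial σ K))⁆ = 0 := by
    refine MvPolynomial.derivation_ext fun k => ?_
    rw [Derivation.commutator_apply, pderiv_X, pderiv_X]
    simp only [Pi.single_apply]
    split_ifs <;> simp
  have := DFunLike.congr_fun h f
  rwa [Derivation.commutator_apply, Derivation.zero_apply, sub_eq_zero] at this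

/-- The gradient of `G` at the point `x`. -/
noncomputable def grad (x : σ → L) (G : MvPolynomial σ K) (i : σ) : L :=
  aeval x (pderiv i G)

/-- The Hessian matrix of `G` at the point `x`. -/
noncomputable def hess (x : σ → L) (G : MvPolynomial σ K) (i j : σ) : L :=
  aeval x (pderiv i (pderiv j G))

omit [Fintype σ] in
theorem hess_symm (x : σ → L) (G : MvPolynomial σ K) (i j : σ) : hess x G i j = hess x G j i := by
  rw [hess, pderiv_comm, hess]

theorem sum_coord_mul_grad {G : MvPolynomial σ K} {d : ℕ} (hG : G.IsHomogeneous d) (x : σ → L) :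
    ∑ i, x i * grad x G i = d * aeval x G := by
  have h := congrArg (aeval x) hG.sum_X_mul_pderiv
  simpa [grad] using h

theorem sum_coord_mul_hess {G : MvPolynomial σ K} {d : ℕ} (hG : G.IsHomogeneous d) (x : σ → L)
    (i : σ) : ∑ j, x j * hess x G j i = (d - 1 : ℕ) * grad x G i :=
  sum_coord_mul_grad hG.pderiv x

theorem sum_mul_grad_eq_zero [CharZero L] {G : MvPolynomial σ K} {d : ℕ} (hd : 2 ≤ d)
    (hG : G.IsHomogeneous d) {x : σ → L} {w : σ → L} (hw : ∀ i, ∑ j, hess x G i j * w j = 0) :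
    ∑ i, w i * grad x G i = 0 := by
  have h : ((d - 1 : ℕ) : L) * ∑ i, w i * grad x G i = 0 := by
    calc ((d - 1 : ℕ) : L) * ∑ i, w i * grad x G i
        = ∑ i, w i * ∑ j, x j * hess x G j i := by
          rw [Finset.mul_sum]
          exact Finset.sum_congr rfl fun i _ => by rw [sum_coord_mul_hess hG]; ring
      _ = ∑ j, x j * ∑ i, hess x G j i * w i := by
          simp only [Finset.mul_sum]
          rw [Finset.sum_comm]
          exact Finset.sum_congr rfl fun i _ => Finset.sum_congr rfl fun j _ => by ring
      _ = 0 := by simp [hw]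
  exact (mul_eq_zero.1 h).resolve_left (Nat.cast_ne_zero.2 (by omega))

variable [DecidableEq σ] {x : σ → L} {pd : σ → Derivation K L L}

theorem pd_grad (hx : ∀ i j, pd i (x j) = if i = j then 1 else 0) (G : MvPolynomial σ K)
    (i j : σ) : pd i (grad x G j) = hess x G i j :=
  pd_aeval hx i _

theorem directional_aeval (hx : ∀ i j, pd i (x j) = if i = j then 1 else 0)
    (G : MvPolynomial σ K) (w : σ → L) :
    directional pd w (aeval x G) = ∑ i, w i * grad x G i := by
  rw [directional_apply]
  exact Finset.sum_congr rfl fun i _ => by rw [pd_aeval hx, grad]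

theorem directional_grad (hx : ∀ i j, pd i (x j) = if i = j then 1 else 0)
    {G : MvPolynomial σ K} {w : σ → L} (hw : ∀ i, ∑ j, hess x G i j * w j = 0) (i : σ) :
    directional pd w (grad x G i) = 0 := by
  rw [directional_apply, ← hw i]
  exact Finset.sum_congr rfl fun j _ => by rw [pd_grad hx, hess_symm, mul_comm]

/-- The kernel of the generic Hessian is stable under differentiation along itself. -/
theorem hess_directional (hx : ∀ i j, pd i (x j) = if i = j then 1 else 0)
    {G : MvPolynomial σ K} {v w : σ → L} (hv : ∀ i, ∑ j, hess x G i j * v j = 0)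
    (hw : ∀ i, ∑ j, hess x G i j * w j = 0) (i : σ) :
    ∑ j, hess x G i j * directional pd v (w j) = 0 := by
  have hT : ∀ k i j, pd k (hess x G i j) = pd i (hess x G j k) := by
    intro k i j
    rw [hess, hess, pd_aeval hx, pd_aeval hx, pderiv_comm k i, pderiv_comm k j]
  have h1 : ∀ k, ∑ j, pd k (hess x G i j) * w j + ∑ j, hess x G i j * pd k (w j) = 0 := by
    intro k
    have := congrArg (pd k) (hw i)
    simp only [map_sum, Derivation.leibniz, map_zero, smul_eq_mul, Finset.sum_add_distrib] at this
    rw [← this, add_comm]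
    simp only [mul_comm]
  have h2 : ∀ j, ∑ k, pd i (hess x G j k) * v k = - ∑ k, hess x G j k * pd i (v k) := by
    intro j
    have := congrArg (pd i) (hv j)
    simp only [map_sum, Derivation.leibniz, map_zero, smul_eq_mul, Finset.sum_add_distrib] at this
    rw [eq_neg_iff_add_eq_zero, ← this, add_comm]
    simp only [mul_comm]
  have h3 : ∑ k, v k * ∑ j, pd k (hess x G i j) * w j = 0 := by
    calc ∑ k, v k * ∑ j, pd k (hess x G i j) * w j
        = ∑ j, w j * ∑ k, pd i (hess x G j k) * v k := by
          simp only [Finset.mul_sum]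
          rw [Finset.sum_comm]
          exact Finset.sum_congr rfl fun j _ => Finset.sum_congr rfl fun k _ => by
            rw [hT]; ring
      _ = - ∑ k, pd i (v k) * ∑ j, hess x G k j * w j := by
          simp only [h2, Finset.mul_sum, mul_neg, Finset.sum_neg_distrib]
          rw [Finset.sum_comm]
          congr 1
          exact Finset.sum_congr rfl fun j _ => Finset.sum_congr rfl fun k _ => by
            rw [hess_symm x G k j]; ring
      _ = 0 := by simp [hw]
  calc ∑ j, hess x G i j * directional pd v (w j)
      = ∑ k, v k * (∑ j, pd k (hess x G i j) * w j + ∑ j, hess x G i j * pd k (w j)) := by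
        simp only [mul_add, Finset.sum_add_distrib]
        rw [h3, zero_add]
        simp only [directional_apply, Finset.mul_sum]
        rw [Finset.sum_comm]
        exact Finset.sum_congr rfl fun j _ => Finset.sum_congr rfl fun k _ => by ring
    _ = 0 := by simp [h1]

end Hessian

/-- Every subspace of `σ → L` has a basis in reduced echelon form. -/
theorem exists_reduced_basis {L σ : Type*} [Field L] [Fintype σ] [DecidableEq σ]
    (W : Submodule L (σ → L)) :
    ∃ (B : Finset σ) (h : B → σ → L), (∀ b, h b ∈ W) ∧
      (∀ b c : B, h b c = if b = c then 1 else 0) ∧ ∀ w ∈ W, w = ∑ b : B, w b • h b := by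
  have hne : ∃ B : Finset σ, ∀ w ∈ W, (∀ b ∈ B, w b = 0) → w = 0 :=
    ⟨Finset.univ, fun w _ hw => funext fun i => hw i (Finset.mem_univ i)⟩
  obtain ⟨B, hB, hmin⟩ : ∃ B : Finset σ, (∀ w ∈ W, (∀ b ∈ B, w b = 0) → w = 0) ∧
      ∀ C ⊂ B, ¬ ∀ w ∈ W, (∀ b ∈ C, w b = 0) → w = 0 := by
    obtain ⟨B, hB⟩ := exists_minimal_of_wellFoundedLT
      (fun B : Finset σ => ∀ w ∈ W, (∀ b ∈ B, w b = 0) → w = 0) hne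
    exact ⟨B, hB.1, fun C hC h => hC.2 (hB.2 h hC.1)⟩
  have hex : ∀ b : B, ∃ h ∈ W, ∀ c : B, h c = if b = c then 1 else 0 := by
    intro b
    have := hmin _ (Finset.erase_ssubset b.2)
    push Not at this
    obtain ⟨w, hw, hwb, hw0⟩ := this
    have hb : w b ≠ 0 := by
      intro hb
      refine hw0 (hB w hw fun c hc => ?_)
      by_cases hcb : c = b
      · rw [hcb, hb]
      · exact hwb c (Finset.mem_erase.2 ⟨hcb, hc⟩)
    refine ⟨(w b)⁻¹ • w, W.smul_mem _ hw, fun c => ?_⟩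
    split_ifs with hbc
    · subst hbc
      simp [hb]
    · have hc : w c = 0 := hwb c (Finset.mem_erase.2 ⟨fun h => hbc (Subtype.ext h.symm), c.2⟩)
      simp [hc]
  choose h hW hh using hex
  refine ⟨B, h, hW, hh, fun w hw => ?_⟩
  rw [← sub_eq_zero]
  refine hB _ (W.sub_mem hw (W.sum_mem fun b _ => W.smul_mem _ (hW b))) fun c hc => ?_
  have hc' : ∀ b : B, h b c = if b = ⟨c, hc⟩ then 1 else 0 := fun b => hh b ⟨c, hc⟩
  simp [Finset.sum_apply, hc']

section TwoPoints

variable {K L E σ ι : Type*} [Field K] [Field L] [CharZero L] [Algebra K L] [Field E] [Algebra K E]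
  [Fintype σ] [DecidableEq σ] [Fintype ι] {x : σ → L} {pd : σ → Derivation K L L}

theorem aeval_smul_translate [Infinite E] (φ : L →ₐ[K] E)
    (hx : ∀ i j, pd i (x j) = if i = j then 1 else 0)
    {u : ι → σ → L} (hu : ∀ a b i, directional pd (u a) (u b i) = 0) {f : MvPolynomial σ K}
    {e : ℕ} (hfe : f.IsHomogeneous e)
    (hf : ∀ a, directional pd (u a) (aeval x f) = 0) (c : E) (α : ι → E) :
    aeval (fun i => c * φ (x i) + ∑ a, α a * φ (u a i)) f = c ^ e * φ (aeval x f) := by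
  have hφ : φ (aeval x f) = aeval (fun i => φ (x i)) f :=
    ringHom_aeval (φ : L →+* E) (RingHom.ext fun a => φ.commutes a) x f
  rw [hφ]
  refine aeval_smul_add_of_isHomogeneous hfe (fun i => φ (x i)) _ (fun t => ?_) c
  rw [← hφ, ← aeval_translate φ hx hu hf (fun a => t * α a)]
  simp only [Finset.mul_sum, mul_assoc]

/-- For dimension reasons, the cone over a line through `φ x` meets the cone over a flat through
`ψ x` in a point off their directions at infinity. -/
theorem exists_meet [Infinite E] {φ ψ : L →ₐ[K] E}
    (hx : ∀ i j, pd i (x j) = if i = j then 1 else 0)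
    {G : MvPolynomial σ K} {d : ℕ} (hd : d ≠ 0) (hG : G.IsHomogeneous d) (hG0 : aeval x G ≠ 0)
    (hsep : ∀ v : σ → L, v ≠ 0 → ∑ i, φ (v i) * ψ (grad x G i) ≠ 0)
    {h : σ → L} (hh : ∀ i, directional pd h (h i) = 0) (hhG : ∑ i, h i * grad x G i = 0)
    (hh0 : h ≠ 0)
    {u : ι → σ → L} (hu : ∀ a b i, directional pd (u a) (u b i) = 0)
    (huG : ∀ a, ∑ i, u a i * grad x G i = 0)
    (hind : ∀ β : ι → E, (∀ i, ∑ a, β a * ψ (u a i) = 0) → β = 0)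
    (hcard : Fintype.card σ < Fintype.card ι + 3) :
    ∃ (l α m : E) (β : ι → E), l ≠ 0 ∧ m ≠ 0 ∧
      ∀ i, l * φ (x i) + α * φ (h i) = m * ψ (x i) + ∑ a, β a * ψ (u a i) := by
  let T : (E × E × E × (ι → E)) →ₗ[E] (σ → E) :=
    { toFun := fun q i => q.1 * φ (x i) + q.2.1 * φ (h i) -
        (q.2.2.1 * ψ (x i) + ∑ a, q.2.2.2 a * ψ (u a i))
      map_add' := fun p q => by
        ext i
        simp [add_mul, Finset.sum_add_distrib]
        ring
      map_smul' := fun c q => by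
        ext i
        simp [mul_assoc, ← Finset.mul_sum]
        ring }
  have hker : LinearMap.ker T ≠ ⊥ := by
    refine LinearMap.ker_ne_bot_of_finrank_lt ?_
    simp
    omega
  obtain ⟨⟨l, α, m, β⟩, hq, hq0⟩ := Submodule.exists_mem_ne_zero_of_ne_bot hker
  have heq : ∀ i, l * φ (x i) + α * φ (h i) = m * ψ (x i) + ∑ a, β a * ψ (u a i) := fun i =>
    sub_eq_zero.1 (congrFun hq i)
  have h1 := aeval_smul_translate φ hx (u := fun _ : Unit => h) (fun _ _ => hh) hG
    (fun _ => by rw [directional_aeval hx, hhG]) l (fun _ => α)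
  have h2 := aeval_smul_translate ψ hx hu hG
    (fun a => by rw [directional_aeval hx, huG]) m β
  simp only [Finset.univ_unique, Finset.sum_singleton, heq] at h1
  rw [h1] at h2
  have hφ0 : φ (aeval x G) ≠ 0 := by simpa using hG0
  have hψ0 : ψ (aeval x G) ≠ 0 := by simpa using hG0
  have hlm : l = 0 ↔ m = 0 := by
    constructor
    · rintro rfl
      simpa [hd, hψ0] using h2.symm
    · rintro rfl
      simpa [hd, hφ0] using h2
  have hm : m ≠ 0 := by
    intro hm
    have hl := hlm.2 hm
    subst hm hl
    simp only [zero_mul, zero_add] at heq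
    have hα : α * ∑ i, φ (h i) * ψ (grad x G i) = 0 := by
      calc α * ∑ i, φ (h i) * ψ (grad x G i)
          = ∑ i, (∑ a, β a * ψ (u a i)) * ψ (grad x G i) := by
            rw [Finset.mul_sum]
            exact Finset.sum_congr rfl fun i _ => by rw [← heq, mul_assoc]
        _ = ∑ a, β a * ψ (∑ i, u a i * grad x G i) := by
            simp only [Finset.sum_mul, map_sum, map_mul, Finset.mul_sum]
            rw [Finset.sum_comm]
            simp only [mul_assoc]
        _ = 0 := by simp [huG]
    have hα0 := (mul_eq_zero.1 hα).resolve_right (hsep h hh0)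
    have hβ := hind β fun i => by rw [← heq, hα0, zero_mul]
    exact hq0 (by rw [hα0, hβ]; rfl)
  exact ⟨l, α, m, β, fun hl => hm (hlm.1 hl), hm, heq⟩

/-- A generic Hessian cannot have corank `m` with `m ≥ 1` and `m ≥ card σ - 2`. -/
theorem false_of_large_corank [Infinite E] {φ ψ : L →ₐ[K] E}
    (hx : ∀ i j, pd i (x j) = if i = j then 1 else 0)
    {G : MvPolynomial σ K} {d : ℕ} (hd : 2 ≤ d) (hG : G.IsHomogeneous d) (hG0 : aeval x G ≠ 0)
    (hsep : ∀ v : σ → L, v ≠ 0 → ∑ i, φ (v i) * ψ (grad x G i) ≠ 0)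
    {B : Finset σ} {h : B → σ → L} (hH : ∀ b i, ∑ j, hess x G i j * h b j = 0)
    (hB : ∀ b c : B, h b c = if b = c then 1 else 0)
    (hflat : ∀ a b i, directional pd (h a) (h b i) = 0)
    (hne : B.Nonempty) (hcard : Fintype.card σ < B.card + 3) : False := by
  obtain ⟨b, hb⟩ := hne
  set b' : B := ⟨b, hb⟩
  have hh0 : h b' ≠ 0 := fun h0 => by
    have := hB b' b'
    simp [h0] at this
  have hgrad : ∀ b, ∑ i, h b i * grad x G i = 0 := fun b => sum_mul_grad_eq_zero hd hG (hH b)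
  obtain ⟨l, α, m, β, hl, hm, heq⟩ := exists_meet hx (by omega) hG hG0 hsep
    (hflat b' b') (hgrad b') hh0 hflat hgrad (fun β hβ => by
      ext c
      have := hβ c
      simpa [hB, apply_ite ψ] using this) (by simpa using hcard)
  have hprop : ∀ i, l ^ (d - 1) * φ (grad x G i) = m ^ (d - 1) * ψ (grad x G i) := by
    intro i
    have h1 := aeval_smul_translate φ hx (u := fun _ : Unit => h b') (fun _ _ => hflat b' b')
      (hG.pderiv (i := i)) (fun _ => directional_grad hx (hH b') i) l (fun _ => α)
    have h2 := aeval_smul_translate ψ hx hflat (hG.pderiv (i := i))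
      (fun b => directional_grad hx (hH b) i) m β
    simp only [Finset.univ_unique, Finset.sum_singleton, heq] at h1
    rw [h1] at h2
    exact h2
  have hz : m ^ (d - 1) * ∑ i, φ (h b' i) * ψ (grad x G i) = 0 := by
    calc m ^ (d - 1) * ∑ i, φ (h b' i) * ψ (grad x G i)
        = l ^ (d - 1) * φ (∑ i, h b' i * grad x G i) := by
          rw [map_sum, Finset.mul_sum, Finset.mul_sum]
          exact Finset.sum_congr rfl fun i _ => by
            rw [map_mul, mul_left_comm, ← hprop]; ring
      _ = 0 := by simp [hgrad]
  exact mul_ne_zero (pow_ne_zero _ hm) (hsep _ hh0) hz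

end TwoPoints

section CorankOne

theorem eq_zero_of_sum_map_mul_eq_zero {K L E σ : Type*} [Field K] [Field L] [Algebra K L]
    [Fintype σ] [Field E] [Algebra K E] (φ : L →ₐ[K] E) {H : σ → σ → L} {b : σ}
    (hker : ∀ w : σ → L, (∀ i, ∑ j, H i j * w j = 0) → w b = 0 → w = 0) {v : σ → E}
    (hv : ∀ i, ∑ j, φ (H i j) * v j = 0) (hvb : v b = 0) : v = 0 := by
  let _ : Algebra L E := (φ : L →+* E).toAlgebra
  have hsmul : ∀ (c : L) (e : E), c • e = φ c * e := fun _ _ => rfl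
  ext j
  refine (Module.forall_dual_apply_eq_zero_iff L (v j)).1 fun f => ?_
  refine congrFun (hker (fun j => f (v j)) (fun i => ?_) (by rw [hvb, map_zero])) j
  have := congrArg f (hv i)
  simpa only [map_sum, ← hsmul, map_smul, smul_eq_mul, map_zero] using this

variable {K L σ : Type*} [Field K] [Field L] [Algebra K L] [Fintype σ]
variable [DecidableEq σ] {x : σ → L} {pd : σ → Derivation K L L}

/-- The Jacobian matrix of a vector field. -/
def jacobian (pd : σ → Derivation K L L) (h : σ → L) : Matrix σ σ L :=
  Matrix.of fun i k => pd k (h i)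

omit [DecidableEq σ] in
theorem jacobian_mulVec (h v : σ → L) (i : σ) :
    (jacobian pd h).mulVec v i = directional pd v (h i) := by
  rw [directional_apply]
  exact Finset.sum_congr rfl fun k _ => mul_comm _ _

theorem hess_directional_coord (hx : ∀ i j, pd i (x j) = if i = j then 1 else 0)
    {G : MvPolynomial σ K} {d : ℕ} (hG : G.IsHomogeneous d) {w : σ → L}
    (hw : ∀ i, ∑ j, hess x G i j * w j = 0) (i : σ) :
    ∑ j, hess x G i j * directional pd x (w j) = 0 := by
  have hE : ∀ j, directional pd x (hess x G i j) = (d - 1 - 1 : ℕ) * hess x G i j := by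
    intro j
    rw [hess, directional_aeval hx, sum_coord_mul_grad hG.pderiv.pderiv]
  have := congrArg (directional pd x) (hw i)
  simp only [map_sum, Derivation.leibniz, map_zero, smul_eq_mul, Finset.sum_add_distrib, hE] at this
  rw [← this, left_eq_add]
  calc ∑ j, w j * ((d - 1 - 1 : ℕ) * hess x G i j)
      = (d - 1 - 1 : ℕ) * ∑ j, hess x G i j * w j := by
        rw [Finset.mul_sum]
        exact Finset.sum_congr rfl fun j _ => by ring
    _ = 0 := by rw [hw, mul_zero]

theorem grad_vecMul_jacobian [CharZero L] (hx : ∀ i j, pd i (x j) = if i = j then 1 else 0)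
    {G : MvPolynomial σ K} {d : ℕ} (hd : 2 ≤ d) (hG : G.IsHomogeneous d) {w : σ → L}
    (hw : ∀ i, ∑ j, hess x G i j * w j = 0) (k : σ) :
    ∑ i, grad x G i * jacobian pd w i k = 0 := by
  have := congrArg (pd k) (sum_mul_grad_eq_zero hd hG hw)
  simp only [map_sum, Derivation.leibniz, map_zero, smul_eq_mul, Finset.sum_add_distrib,
    pd_grad hx] at this
  have h0 : ∑ i, w i * hess x G k i = 0 := by
    rw [← hw k]
    exact Finset.sum_congr rfl fun j _ => mul_comm _ _
  rwa [h0, zero_add] at this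

/-- Derivative of the invariance of the gradient under translation along `h`. -/
theorem C_hess_eq [CharZero L] (hx : ∀ i j, pd i (x j) = if i = j then 1 else 0)
    {G : MvPolynomial σ K} {h : σ → L} (hH : ∀ i, ∑ j, hess x G i j * h j = 0)
    (hflat : ∀ i, directional pd h (h i) = 0) (i k : σ) :
    C (hess x G i k) =
      aeval (genericTranslate x fun _ : Unit => h) (pderiv i (pderiv k G)) +
        X () * ∑ j, C (jacobian pd h j k) *
          aeval (genericTranslate x fun _ : Unit => h) (pderiv i (pderiv j G)) := by
  have h1 := sum_aeval_genericTranslate (u := fun _ : Unit => h) hx (fun _ _ => hflat)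
    (τ := Unit) (c := fun _ => 1) (g := fun _ => pderiv i G) (by simp)
    (fun _ => by simpa [grad] using directional_grad hx hH i)
  simp only [Finset.univ_unique, Finset.sum_singleton, map_one, one_mul] at h1
  have h2 := congrArg (coeffDerivation Unit (pd k)) h1
  rw [coeffDerivation_C, ← grad, pd_grad hx, derivation_aeval] at h2
  rw [hess_symm, ← h2]
  have h3 : ∀ j, coeffDerivation Unit (pd k) (genericTranslate x (fun _ : Unit => h) j) =
      (if k = j then 1 else 0) + X () * C (jacobian pd h j k) := by
    intro j
    rw [coeffDerivation_genericTranslate, hx, Fintype.sum_unique]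
    split_ifs <;> simp [jacobian]
  generalize genericTranslate x (fun _ : Unit => h) = p at h3 ⊢
  simp only [h3, pderiv_comm i]
  simp only [mul_add, Finset.sum_add_distrib, mul_ite, mul_one, mul_zero,
    Finset.sum_ite_eq, Finset.mem_univ, if_true, Finset.mul_sum]
  rw [add_right_inj]
  exact Finset.sum_congr rfl fun j _ => by ring

theorem isNilpotent_jacobian [CharZero L] (hx : ∀ i j, pd i (x j) = if i = j then 1 else 0)
    {G : MvPolynomial σ K} {h : σ → L} (hH : ∀ i, ∑ j, hess x G i j * h j = 0)
    (hflat : ∀ i, directional pd h (h i) = 0) {b : σ} (hb : h b = 1)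
    (hker : ∀ w : σ → L, (∀ i, ∑ j, hess x G i j * w j = 0) → w b = 0 → w = 0) :
    IsNilpotent (jacobian pd h) := by
  set J := jacobian pd h with hJ
  set P : σ → σ → MvPolynomial Unit L := fun i j =>
    aeval (genericTranslate x fun _ : Unit => h) (pderiv i (pderiv j G)) with hP
  have hid : ∀ i k, C (hess x G i k) = P i k + X () * ∑ j, C (J j k) * P i j :=
    C_hess_eq hx hH hflat
  let M : ℕ → Matrix σ σ L := fun n => Matrix.of fun i j => coeff (Finsupp.single () n) (P i j)
  have hM0 : M 0 = Matrix.of (hess x G) := by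
    ext i j
    simp [M, hP, coeff_zero_aeval_genericTranslate, hess]
  have hMs : ∀ n, M (n + 1) = - (M n * J) := by
    intro n
    ext i k
    have := congrArg (coeff (Finsupp.single () 1 + Finsupp.single () n)) (hid i k)
    have hne : (0 : Unit →₀ ℕ) ≠ Finsupp.single () (1 + n) := fun h => by
      have := DFunLike.congr_fun h ()
      simp at this
      omega
    rw [coeff_add, coeff_X_mul, ← Finsupp.single_add, coeff_C, if_neg hne, coeff_sum,
      add_comm 1 n] at this
    simp only [coeff_C_mul] at this
    have h' : (M n * J) i k = ∑ j, J j k * coeff (Finsupp.single () n) (P i j) :=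
      Finset.sum_congr rfl fun j _ => mul_comm _ _
    exact eq_neg_of_add_eq_zero_left (h' ▸ this.symm)
  have hMn : ∀ n, M n = (-1) ^ n • (Matrix.of (hess x G) * J ^ n) := by
    intro n
    induction n with
    | zero => simp [hM0]
    | succ n ih => rw [hMs, ih, pow_succ, pow_succ]; simp [mul_assoc]
  obtain ⟨N, hN⟩ : ∃ N, ∀ i j, (P i j).totalDegree < N + 1 :=
    ⟨∑ i, ∑ j, (P i j).totalDegree, fun i j => Nat.lt_succ_of_le <|
      (Finset.single_le_sum (f := fun j => (P i j).totalDegree) (fun _ _ => Nat.zero_le _)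
        (Finset.mem_univ j)).trans
      (Finset.single_le_sum (f := fun i => ∑ j, (P i j).totalDegree) (fun _ _ => Nat.zero_le _)
        (Finset.mem_univ i))⟩
  have hMN : M (N + 1) = 0 := by
    ext i j
    refine coeff_eq_zero_of_totalDegree_lt ?_
    rw [← Finsupp.degree_apply, Finsupp.degree_single]
    exact hN i j
  have hHJ : Matrix.of (hess x G) * J ^ (N + 1) = 0 := by
    have := hMn (N + 1)
    rw [hMN] at this
    rcases neg_one_pow_eq_or ℤ (N + 1) with h | h <;> simpa [h] using this.symm
  refine ⟨N + 1, ?_⟩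
  ext i k
  refine congrFun (hker (fun j => (J ^ (N + 1)) j k) (fun i => ?_) ?_) i
  · exact congrFun (congrFun hHJ i) k
  · rw [pow_succ', Matrix.mul_apply]
    refine Finset.sum_eq_zero fun j _ => ?_
    simp [hJ, jacobian, hb]

end CorankOne

section RankOne

/-- A nonzero nilpotent `4 × 4` matrix whose kernel contains a plane meeting the image trivially
has rank one. -/
theorem exists_rank_one_of_isNilpotent {L σ : Type*} [Field L] [Fintype σ] [DecidableEq σ]
    {J : Matrix σ σ L} (hJ : IsNilpotent J) (hJ0 : J ≠ 0) (hcard : Fintype.card σ ≤ 4)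
    {x h : σ → L} (hJx : J.mulVec x = 0) (hJh : J.mulVec h = 0)
    (hxh : LinearIndependent L ![x, h])
    (himage : ∀ v ∈ Submodule.span L {x, h}, v ∈ LinearMap.range J.mulVecLin → v = 0) :
    ∃ (a : σ → L) (c : σ), a c = 1 ∧ ∀ i k, J i k = a i * J c k := by
  have hspan : Module.finrank L (Submodule.span L {x, h}) = 2 := by
    have := finrank_span_eq_card hxh
    rwa [Matrix.range_cons, Matrix.range_cons, Matrix.range_empty, Set.union_empty,
      Set.singleton_union, Fintype.card_fin] at this
  have hle : Submodule.span L {x, h} ≤ LinearMap.ker J.mulVecLin := by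
    rw [Submodule.span_le, Set.pair_subset_iff]
    exact ⟨hJx, hJh⟩
  have hker : 3 ≤ Module.finrank L (LinearMap.ker J.mulVecLin) := by
    by_contra hlt
    have heq := Submodule.eq_of_le_of_finrank_le hle (by omega)
    have hpow : ∀ n, J ^ (n + 1) = 0 → J = 0 := by
      intro n
      induction n with
      | zero => simp
      | succ n ih =>
        refine fun hn => ih (Matrix.ext_of_mulVec_single fun k => ?_)
        rw [Matrix.zero_mulVec]
        refine himage _ (heq ▸ ?_) ⟨(J ^ n).mulVec (Pi.single k 1), ?_⟩
        · rw [LinearMap.mem_ker, Matrix.mulVecLin_apply, Matrix.mulVec_mulVec, ← pow_succ', hn,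
            Matrix.zero_mulVec]
        · rw [Matrix.mulVecLin_apply, Matrix.mulVec_mulVec, ← pow_succ']
    obtain ⟨n, hn⟩ := hJ
    exact hJ0 (hpow n (by rw [pow_succ, hn, zero_mul]))
  have hrank : Module.finrank L (LinearMap.range J.mulVecLin) ≤ 1 := by
    have := LinearMap.finrank_range_add_finrank_ker J.mulVecLin
    rw [Module.finrank_fintype_fun_eq_card] at this
    omega
  obtain ⟨v, hv⟩ := finrank_le_one_iff.1 hrank
  have hcol : ∀ k, ∃ s : L, ∀ i, J i k = s * v.1 i := by
    intro k
    obtain ⟨s, hs⟩ := hv ⟨J.mulVec (Pi.single k 1), ⟨Pi.single k 1, rfl⟩⟩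
    refine ⟨s, fun i => ?_⟩
    have := congrFun (congrArg Subtype.val hs) i
    simpa using this.symm
  choose s hs using hcol
  obtain ⟨c, hc⟩ : ∃ c, v.1 c ≠ 0 := by
    by_contra! hc
    exact hJ0 (Matrix.ext fun i k => by rw [hs, hc, mul_zero, Matrix.zero_apply])
  refine ⟨fun i => v.1 i / v.1 c, c, div_self hc, fun i k => ?_⟩
  rw [hs, hs]
  field_simp

variable {K L E σ : Type*} [Field K] [Field L] [CharZero L] [Algebra K L] [Field E] [Algebra K E]
  [Fintype σ] [DecidableEq σ] {x : σ → L} {pd : σ → Derivation K L L}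

/-- A vector field in the kernel of the generic Hessian whose coordinates are constants would
give a linear relation between the partial derivatives. -/
theorem jacobian_ne_zero {φ ψ : L →ₐ[K] E} (hx : ∀ i j, pd i (x j) = if i = j then 1 else 0)
    {G : MvPolynomial σ K}
    (hsep : ∀ v : σ → L, v ≠ 0 → ∑ i, φ (v i) * ψ (grad x G i) ≠ 0)
    {h : σ → L} (hh : h ≠ 0) (hhG : ∑ i, h i * grad x G i = 0) : jacobian pd h ≠ 0 := by
  intro hJ
  have hpd : ∀ u j, directional pd u (h j) = 0 := by
    intro u j
    rw [← jacobian_mulVec, hJ, Matrix.zero_mulVec, Pi.zero_apply]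
  have hone : ∀ a b i : σ, directional pd (Pi.single a 1) ((Pi.single b 1 : σ → L) i) = 0 := by
    intro a b i
    rw [Pi.single_apply]
    split_ifs <;> simp
  have := sum_aeval_translate φ hx (u := fun a : σ => Pi.single a (1 : L)) hone
    (c := h) (g := fun i => pderiv i G) (fun a => hpd _)
    (fun a => by rw [← map_zero (directional pd (Pi.single a (1 : L))), ← hhG]; rfl)
    (fun a => ψ (x a) - φ (x a))
  refine hsep h hh ?_
  simp only [grad] at hhG
  rw [hhG, map_zero] at this
  rw [← this]
  refine Finset.sum_congr rfl fun i _ => ?_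
  rw [grad, show ψ (aeval x (pderiv i G)) = aeval (fun i => ψ (x i)) (pderiv i G) from
    ringHom_aeval (ψ : L →+* E) (RingHom.ext fun a => ψ.commutes a) x _]
  simp [Pi.single_apply, apply_ite φ]

omit [CharZero L] [DecidableEq σ] in
/-- A rank one Jacobian of a null vector field, in the direction `a`: the field `a` is constant
along `h` and along `a`, and so is `h`. -/
theorem directional_eq_zero_of_rank_one (hcomm : ∀ i j z, pd i (pd j z) = pd j (pd i z))
    {h a : σ → L} {c : σ} (hJ0 : jacobian pd h ≠ 0)
    (hJ : ∀ i k, jacobian pd h i k = a i * jacobian pd h c k)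
    {v : σ → L} (hv : ∑ k, jacobian pd h c k * v k = 0) (i : σ) :
    directional pd v (h i) = 0 ∧ directional pd v (a i) = 0 := by
  obtain ⟨k₀, hk₀⟩ : ∃ k, jacobian pd h c k ≠ 0 := by
    by_contra! hc
    exact hJ0 (Matrix.ext fun i k => by rw [hJ, hc, mul_zero, Matrix.zero_apply])
  constructor
  · rw [← jacobian_mulVec]
    calc ∑ k, jacobian pd h i k * v k = a i * ∑ k, jacobian pd h c k * v k := by
          rw [Finset.mul_sum]
          exact Finset.sum_congr rfl fun k _ => by rw [hJ, mul_assoc]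
      _ = 0 := by rw [hv, mul_zero]
  · have hcross : ∀ k l, pd l (a i) * jacobian pd h c k = pd k (a i) * jacobian pd h c l := by
      intro k l
      have h1 : pd l (jacobian pd h i k) = pd k (jacobian pd h i l) := hcomm _ _ _
      have h2 : pd l (jacobian pd h c k) = pd k (jacobian pd h c l) := hcomm _ _ _
      rw [hJ, hJ i l, Derivation.leibniz, Derivation.leibniz, h2] at h1
      simp only [smul_eq_mul, add_right_inj] at h1
      rw [mul_comm, h1, mul_comm]
    refine (mul_eq_zero.1 ?_).resolve_right hk₀
    rw [directional_apply, Finset.sum_mul]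
    calc ∑ l, v l * pd l (a i) * jacobian pd h c k₀
        = pd k₀ (a i) * ∑ l, jacobian pd h c l * v l := by
          rw [Finset.mul_sum]
          exact Finset.sum_congr rfl fun l _ => by rw [mul_assoc, hcross]; ring
      _ = 0 := by rw [hv, mul_zero]

end RankOne

section FourVariables

variable {K L E σ : Type*} [Field K] [Field L] [CharZero L] [Algebra K L] [Field E] [Algebra K E]
  [Fintype σ] [DecidableEq σ] {x : σ → L} {pd : σ → Derivation K L L}

/-- The Jacobian of the kernel field of a generic Hessian of corank one in four variables has
rank one, with image spanned by a field `a` which is constant along itself and along `h`. -/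
theorem exists_jacobian_direction {φ ψ : L →ₐ[K] E}
    (hx : ∀ i j, pd i (x j) = if i = j then 1 else 0)
    {G : MvPolynomial σ K} {d : ℕ} (hd : 2 ≤ d) (hG : G.IsHomogeneous d) (hG0 : aeval x G ≠ 0)
    (hsep : ∀ v : σ → L, v ≠ 0 → ∑ i, φ (v i) * ψ (grad x G i) ≠ 0)
    {h : σ → L} (hH : ∀ i, ∑ j, hess x G i j * h j = 0) {b : σ} (hb : h b = 1)
    (hker : ∀ w : σ → L, (∀ i, ∑ j, hess x G i j * w j = 0) → w b = 0 → w = 0)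
    (hcard : Fintype.card σ ≤ 4) :
    ∃ (a : σ → L) (c : σ), a c = 1 ∧ a b = 0 ∧
      (∀ i k, jacobian pd h i k = a i * jacobian pd h c k) ∧
      ∑ k, jacobian pd h c k * h k = 0 ∧ ∑ k, jacobian pd h c k * a k = 0 ∧
      ∑ i, a i * grad x G i = 0 ∧ jacobian pd h ≠ 0 := by
  have hflat : ∀ i, directional pd h (h i) = 0 := congrFun <|
    hker (fun i => directional pd h (h i)) (hess_directional hx hH hH) (by simp [hb])
  have hEuler : ∀ i, directional pd x (h i) = 0 := congrFun <|
    hker (fun i => directional pd x (h i)) (hess_directional_coord hx hG hH) (by simp [hb])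
  have hJh : (jacobian pd h).mulVec h = 0 := funext fun i => by
    rw [jacobian_mulVec, hflat, Pi.zero_apply]
  have hJx : (jacobian pd h).mulVec x = 0 := funext fun i => by
    rw [jacobian_mulVec, hEuler, Pi.zero_apply]
  have hnil := isNilpotent_jacobian hx hH hflat hb hker
  have hhG := sum_mul_grad_eq_zero hd hG hH
  have hh0 : h ≠ 0 := fun h0 => by simp [h0] at hb
  have hJ0 : jacobian pd h ≠ 0 := jacobian_ne_zero hx hsep hh0 hhG
  have hJG := grad_vecMul_jacobian hx hd hG hH
  have hJb : ∀ k, jacobian pd h b k = 0 := fun k => by simp [jacobian, hb]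
  have hpair : ∀ s t : L, ∑ i, (s • x + t • h) i * grad x G i = 0 → (s • x + t • h) b = 0 →
      s = 0 ∧ t = 0 := by
    intro s t hsum hstb
    have hs : s = 0 := by
      have h1 : s * (d * aeval x G) = 0 := by
        rw [← sum_coord_mul_grad hG x, ← hsum]
        simp only [Pi.add_apply, Pi.smul_apply, smul_eq_mul, add_mul, Finset.sum_add_distrib,
          mul_assoc, ← Finset.mul_sum, hhG, mul_zero, add_zero]
      exact (mul_eq_zero.1 h1).resolve_right
        (mul_ne_zero (Nat.cast_ne_zero.2 (by omega)) hG0)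
    refine ⟨hs, ?_⟩
    simpa [hs, hb] using hstb
  obtain ⟨a, c, hac, ha⟩ := exists_rank_one_of_isNilpotent hnil hJ0 hcard hJx hJh
    (LinearIndependent.pair_iff.2 fun s t hst =>
      hpair s t (by rw [hst]; simp) (by rw [hst]; rfl)) (by
      rintro v hv ⟨u, rfl⟩
      obtain ⟨s, t, hst⟩ := Submodule.mem_span_pair.1 hv
      obtain ⟨rfl, rfl⟩ := hpair s t (by
        rw [hst]
        calc ∑ i, (∑ k, jacobian pd h i k * u k) * grad x G i
            = ∑ k, u k * ∑ i, grad x G i * jacobian pd h i k := by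
              simp only [Finset.sum_mul, Finset.mul_sum]
              rw [Finset.sum_comm]
              exact Finset.sum_congr rfl fun _ _ => Finset.sum_congr rfl fun _ _ => by ring
          _ = 0 := by simp [hJG]) (by
        rw [hst]
        exact Finset.sum_eq_zero fun k _ => mul_eq_zero_of_left (hJb k) _)
      rw [← hst, zero_smul, zero_smul, add_zero])
  obtain ⟨k₀, hk₀⟩ : ∃ k, jacobian pd h c k ≠ 0 := by
    by_contra! hc
    exact hJ0 (Matrix.ext fun i k => by rw [ha, hc, mul_zero, Matrix.zero_apply])
  refine ⟨a, c, hac, ?_, ha, congrFun hJh c, ?_, ?_, hJ0⟩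
  · have := hJb k₀
    rw [ha] at this
    exact (mul_eq_zero.1 this).resolve_right hk₀
  · obtain ⟨N, hN⟩ := hnil
    have hpow : ∀ n, ((jacobian pd h) ^ n).mulVec a =
        (∑ k, jacobian pd h c k * a k) ^ n • a := by
      intro n
      induction n with
      | zero => simp
      | succ n ih =>
        rw [pow_succ', ← Matrix.mulVec_mulVec, ih, Matrix.mulVec_smul, pow_succ, mul_smul]
        congr 1
        ext i
        rw [Pi.smul_apply, smul_eq_mul, Finset.sum_mul]
        exact Finset.sum_congr rfl fun k _ => by
          rw [show (fun j => jacobian pd h i j) k = a i * jacobian pd h c k from ha i k]; ring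
    have := congrFun (hpow N) c
    rw [hN, Matrix.zero_mulVec, Pi.smul_apply, hac, smul_eq_mul, mul_one, Pi.zero_apply] at this
    exact eq_zero_of_pow_eq_zero this.symm
  · refine (mul_eq_zero.1 ?_).resolve_right hk₀
    rw [← hJG k₀, Finset.sum_mul]
    exact Finset.sum_congr rfl fun i _ => by rw [ha i]; ring

/-- A generic Hessian in at most four variables cannot have corank one. -/
theorem false_of_corank_one [Infinite E] {φ ψ : L →ₐ[K] E}
    (hx : ∀ i j, pd i (x j) = if i = j then 1 else 0)
    (hcomm : ∀ i j z, pd i (pd j z) = pd j (pd i z))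
    {G : MvPolynomial σ K} {d : ℕ} (hd : 2 ≤ d) (hG : G.IsHomogeneous d) (hG0 : aeval x G ≠ 0)
    (hsep : ∀ v : σ → L, v ≠ 0 → ∑ i, φ (v i) * ψ (grad x G i) ≠ 0)
    {h : σ → L} (hH : ∀ i, ∑ j, hess x G i j * h j = 0) {b : σ} (hb : h b = 1)
    (hker : ∀ w : σ → L, (∀ i, ∑ j, hess x G i j * w j = 0) → w b = 0 → w = 0)
    (hcard : Fintype.card σ ≤ 4) : False := by
  obtain ⟨a, c, hac, hab, hJ, hωh, hωa, haG, hJ0⟩ :=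
    exists_jacobian_direction hx hd hG hG0 hsep hH hb hker hcard
  have hhG := sum_mul_grad_eq_zero hd hG hH
  have hh0 : h ≠ 0 := fun h0 => by simp [h0] at hb
  have hh := fun i => directional_eq_zero_of_rank_one hcomm hJ0 hJ hωh i
  have ha := fun i => directional_eq_zero_of_rank_one hcomm hJ0 hJ hωa i
  have hu : ∀ p q i, directional pd ((![h, a] : Fin 2 → σ → L) p)
      ((![h, a] : Fin 2 → σ → L) q i) = 0 := by
    simp [Fin.forall_fin_two, hh, ha]
  obtain ⟨l, α, m, β, hl, hm, heq⟩ := exists_meet hx (by omega) hG hG0 hsep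
    (fun i => (hh i).1) hhG hh0 hu (by simp [Fin.forall_fin_two, hhG, haG]) (fun β hβ => by
      have h0 : β 0 = 0 := by simpa [hb, hab] using hβ b
      have h1 : β 1 = 0 := by simpa [h0, hac] using hβ c
      ext p
      fin_cases p <;> assumption) (by simp; omega)
  set t : E := α / l with ht
  let P : σ → σ → E := fun i j => aeval (fun k => φ (x k) + t * φ (h k)) (pderiv i (pderiv j G))
  have hid : ∀ i k, φ (hess x G i k) = P i k + t * ∑ j, φ (jacobian pd h j k) * P i j := by
    intro i k
    have := congrArg (eval₂Hom (φ : L →+* E) fun _ => t) (C_hess_eq hx hH (fun i => (hh i).1) i k)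
    have hφ : (eval₂Hom (φ : L →+* E) fun _ => t).comp (algebraMap K (MvPolynomial Unit L)) =
        algebraMap K E := by
      refine RingHom.ext fun a => ?_
      rw [RingHom.comp_apply, MvPolynomial.algebraMap_apply, coe_eval₂Hom, eval₂_C]
      exact φ.commutes a
    simp only [map_sum, map_mul, map_add, ringHom_aeval _ hφ] at this
    simpa [genericTranslate, P] using this
  have hPl : ∀ i j, aeval (fun k => l * φ (x k) + α * φ (h k)) (pderiv i (pderiv j G)) =
      l ^ (d - 1 - 1) * P i j := by
    intro i j
    rw [← aeval_smul_of_isHomogeneous hG.pderiv.pderiv]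
    congr 2
    ext k
    rw [ht]
    field_simp
  have hPh : ∀ i, ∑ j, ψ (h j) * P i j = 0 := by
    intro i
    have hH' : ∀ i, ∑ j, h j * hess x G i j = 0 := fun i => by
      rw [← hH i]
      exact Finset.sum_congr rfl fun j _ => mul_comm _ _
    have h1 := sum_aeval_translate ψ hx hu (c := h) (g := fun j => pderiv i (pderiv j G))
      (fun p j => by fin_cases p <;> simp [hh, ha])
      (fun p => by
        rw [← map_zero (directional pd ((![h, a] : Fin 2 → σ → L) p)), ← hH' i]
        rfl)
      (fun p => β p / m)
    have h2 : ∀ j, l ^ (d - 1 - 1) * P i j = m ^ (d - 1 - 1) *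
        aeval (fun k => ψ (x k) + ∑ p, β p / m * ψ ((![h, a] : Fin 2 → σ → L) p k))
          (pderiv i (pderiv j G)) := by
      intro j
      rw [← hPl, ← aeval_smul_of_isHomogeneous hG.pderiv.pderiv]
      congr 2
      ext k
      rw [heq, mul_add, Finset.mul_sum]
      congr 1
      refine Finset.sum_congr rfl fun p _ => ?_
      field_simp
    refine (mul_eq_zero.1 ?_).resolve_left (pow_ne_zero (d - 1 - 1) hl)
    calc l ^ (d - 1 - 1) * ∑ j, ψ (h j) * P i j
        = ∑ j, ψ (h j) * (l ^ (d - 1 - 1) * P i j) := by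
          rw [Finset.mul_sum]
          exact Finset.sum_congr rfl fun _ _ => mul_left_comm _ _ _
      _ = m ^ (d - 1 - 1) * ψ (∑ j, h j * hess x G i j) := by
          simp only [h2]
          rw [show ∑ j, h j * hess x G i j = ∑ j, h j * aeval x (pderiv i (pderiv j G)) from rfl,
            ← h1, Finset.mul_sum]
          exact Finset.sum_congr rfl fun _ _ => mul_left_comm _ _ _
      _ = 0 := by
          rw [hH', map_zero, mul_zero]
  set s : E := ∑ k, φ (jacobian pd h c k) * ψ (h k) with hs
  clear_value s
  have hωa' : ∑ k, φ (jacobian pd h c k) * φ (a k) = 0 := by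
    simp only [← map_mul, ← map_sum, hωa, map_zero]
  have hωh' : ∑ k, φ (jacobian pd h c k) * φ (h k) = 0 := by
    simp only [← map_mul, ← map_sum, hωh, map_zero]
  have hHh' : ∀ i, ∑ k, φ (hess x G i k) * φ (h k) = 0 := by
    intro i
    simp only [← map_mul, ← map_sum, hH, map_zero]
  have hHv : ∀ i, ∑ k, φ (hess x G i k) * (ψ (h k) - t * s * φ (a k)) = 0 := by
    intro i
    set A : E := ∑ j, φ (a j) * P i j with hA
    have h1 : ∀ k, φ (hess x G i k) = P i k + t * A * φ (jacobian pd h c k) := by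
      intro k
      rw [hid, hA, Finset.mul_sum, Finset.mul_sum, Finset.sum_mul]
      congr 1
      exact Finset.sum_congr rfl fun j _ => by rw [hJ j k, map_mul]; ring
    calc ∑ k, φ (hess x G i k) * (ψ (h k) - t * s * φ (a k))
        = ∑ k, ψ (h k) * P i k + t * A * ∑ k, φ (jacobian pd h c k) * ψ (h k)
          - t * s * ∑ k, φ (a k) * P i k
          - t * A * (t * s) * ∑ k, φ (jacobian pd h c k) * φ (a k) := by
          simp only [Finset.mul_sum, ← Finset.sum_add_distrib, ← Finset.sum_sub_distrib]
          exact Finset.sum_congr rfl fun k _ => by rw [h1]; ring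
      _ = 0 := by rw [hPh, hωa', ← hs, ← hA]; ring
  have hv := eq_zero_of_sum_map_mul_eq_zero φ hker
    (v := fun k => ψ (h k) - t * s * φ (a k) - φ (h k)) (fun i => by
      simp only [mul_sub _ _ (φ (h _)), Finset.sum_sub_distrib, hHv, hHh', sub_zero])
    (by simp [hb, hab])
  have hψ : ∀ k, ψ (h k) = φ (h k) + t * s * φ (a k) := by
    intro k
    have := congrFun hv k
    simp only [Pi.zero_apply] at this
    linear_combination this
  have hs0 : s = 0 := by
    rw [hs]
    simp only [hψ, mul_add, Finset.sum_add_distrib, hωh', zero_add]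
    calc ∑ k, φ (jacobian pd h c k) * (t * s * φ (a k))
        = t * s * ∑ k, φ (jacobian pd h c k) * φ (a k) := by
          rw [Finset.mul_sum]
          exact Finset.sum_congr rfl fun k _ => mul_left_comm _ _ _
      _ = 0 := by rw [hωa', mul_zero]
  refine hsep h hh0 ?_
  have : ∀ i, φ (h i) = ψ (h i) := fun i => by rw [hψ, hs0]; ring
  simp only [this, ← map_mul, ← map_sum, hhG, map_zero]

end FourVariables

section FunctionField

theorem exists_derivation_extension {K A L : Type*} [CommRing K] [CommRing A] [IsDomain A]
    [Algebra K A] [Field L] [Algebra A L] [Algebra K L] [IsScalarTower K A L] [IsFractionRing A L]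
    (D : Derivation K A A) :
    ∃ D' : Derivation K L L, ∀ a, D' (algebraMap A L a) = algebraMap A L (D a) := by
  let f : A →+* TrivSqZeroExt L L :=
    { toFun := fun a =>
        TrivSqZeroExt.inl (algebraMap A L a) + TrivSqZeroExt.inr (algebraMap A L (D a))
      map_one' := by ext <;> simp
      map_mul' := fun a b => by
        refine TrivSqZeroExt.ext (by simp) ?_
        simp only [TrivSqZeroExt.snd_add, TrivSqZeroExt.snd_inl, TrivSqZeroExt.snd_inr,
          TrivSqZeroExt.snd_mul, TrivSqZeroExt.fst_add, TrivSqZeroExt.fst_inl,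
          TrivSqZeroExt.fst_inr, Derivation.leibniz, map_add, smul_eq_mul, map_mul,
          op_smul_eq_smul, zero_add, add_zero]
      map_zero' := by ext <;> simp
      map_add' := fun a b => by ext <;> simp [Algebra.smul_def] }
  have hf : ∀ y : nonZeroDivisors A, IsUnit (f y) := by
    intro y
    rw [TrivSqZeroExt.isUnit_iff_isUnit_fst]
    simp [f]
  let g : L →+* TrivSqZeroExt L L := IsLocalization.lift hf
  have hg : ∀ a, g (algebraMap A L a) = f a := fun a => IsLocalization.lift_eq hf a
  have hfst : ∀ z, (g z).fst = z := by
    have : (TrivSqZeroExt.fstHom L L L : TrivSqZeroExt L L →+* L).comp g = RingHom.id L := by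
      refine IsLocalization.ringHom_ext (nonZeroDivisors A) (RingHom.ext fun a => ?_)
      simp [hg, f]
    exact fun z => RingHom.congr_fun this z
  have hK : ∀ r : K, g (algebraMap K L r) = TrivSqZeroExt.inl (algebraMap K L r) := by
    intro r
    rw [IsScalarTower.algebraMap_apply K A L, hg]
    simp [f]
  refine ⟨Derivation.mk'
    { toFun := fun z => (g z).snd
      map_add' := fun y z => by simp
      map_smul' := fun r z => by simp [Algebra.smul_def, hK] } fun y z => ?_, fun a => ?_⟩
  · change (g (y * z)).snd = y * (g z).snd + z * (g y).snd
    rw [map_mul, TrivSqZeroExt.snd_mul, hfst, hfst, op_smul_eq_smul, smul_eq_mul, smul_eq_mul]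
  · change (g (algebraMap A L a)).snd = _
    rw [hg]
    simp only [f, RingHom.coe_mk, MonoidHom.coe_mk, OneHom.coe_mk, TrivSqZeroExt.snd_add,
      TrivSqZeroExt.snd_inl, TrivSqZeroExt.snd_inr, zero_add]

theorem derivation_eq_zero_of_forall_algebraMap {K A L : Type*} [CommRing K] [CommRing A]
    [IsDomain A] [Field L] [Algebra A L] [Algebra K L] [IsFractionRing A L]
    (D : Derivation K L L) (hD : ∀ a, D (algebraMap A L a) = 0) : D = 0 := by
  ext z
  obtain ⟨a, b, hb, rfl⟩ := IsFractionRing.div_surjective (A := A) z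
  have hb' : algebraMap A L b ≠ 0 := by simpa using nonZeroDivisors.ne_zero hb
  have h := D.leibniz (algebraMap A L a / algebraMap A L b) (algebraMap A L b)
  rw [div_mul_cancel₀ _ hb', hD, hD, smul_zero, zero_add, smul_eq_mul] at h
  exact (mul_eq_zero.1 h.symm).resolve_left hb'

variable {K σ : Type*} [Field K]

/-- The coordinates of the generic point. -/
noncomputable def genericPoint (K σ : Type*) [Field K] (j : σ) : FractionRing (MvPolynomial σ K) :=
  algebraMap _ _ (X j : MvPolynomial σ K)

theorem aeval_genericPoint (f : MvPolynomial σ K) :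
    aeval (genericPoint K σ) f = algebraMap _ (FractionRing (MvPolynomial σ K)) f := by
  have : aeval (genericPoint K σ) =
      IsScalarTower.toAlgHom K (MvPolynomial σ K) (FractionRing (MvPolynomial σ K)) :=
    algHom_ext fun j => by simp [genericPoint]
  rw [this]
  rfl

theorem exists_partial_derivatives [Fintype σ] [DecidableEq σ] :
    ∃ pd : σ → Derivation K (FractionRing (MvPolynomial σ K)) (FractionRing (MvPolynomial σ K)),
      (∀ i j, pd i (genericPoint K σ j) = if i = j then 1 else 0) ∧
      ∀ i j z, pd i (pd j z) = pd j (pd i z) := by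
  choose pd hpd using fun i : σ => exists_derivation_extension
    (L := FractionRing (MvPolynomial σ K))
    (pderiv i : Derivation K (MvPolynomial σ K) (MvPolynomial σ K))
  have hx : ∀ i j, pd i (genericPoint K σ j) = if i = j then 1 else 0 := by
    intro i j
    rw [genericPoint, hpd, pderiv_X, Pi.single_apply]
    simp only [eq_comm]
    split_ifs <;> simp
  refine ⟨pd, hx, fun i j z => ?_⟩
  have h0 : ⁅pd i, pd j⁆ = 0 := by
    refine derivation_eq_zero_of_forall_algebraMap (A := MvPolynomial σ K) _ fun f => ?_
    rw [Derivation.commutator_apply, hpd, hpd, hpd, hpd, pderiv_comm, sub_self]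
  have := DFunLike.congr_fun h0 z
  rwa [Derivation.commutator_apply, Derivation.zero_apply, sub_eq_zero] at this

/-- Two independent generic points: embeddings `φ` and `ψ` of `K(x)` into `K(x, y)`, the first one
the inclusion and the second one sending `x` to `y`. -/
theorem exists_two_generic_points (K σ : Type*) [Field K] :
    ∃ φ ψ : FractionRing (MvPolynomial σ K) →ₐ[K]
        FractionRing (MvPolynomial σ (FractionRing (MvPolynomial σ K))),
      (∀ z, φ z = algebraMap _ _ (C z : MvPolynomial σ (FractionRing (MvPolynomial σ K)))) ∧
      ∀ f : MvPolynomial σ K, ψ (aeval (genericPoint K σ) f) =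
        algebraMap _ _ (map (algebraMap K (FractionRing (MvPolynomial σ K))) f) := by
  set L := FractionRing (MvPolynomial σ K)
  set E := FractionRing (MvPolynomial σ L)
  let g : MvPolynomial σ K →ₐ[K] E :=
    (IsScalarTower.toAlgHom K (MvPolynomial σ L) E).comp (mapAlgHom (Algebra.ofId K L))
  have hg : Function.Injective g :=
    (IsFractionRing.injective (MvPolynomial σ L) E).comp
      (map_injective _ (algebraMap K L).injective)
  refine ⟨(IsScalarTower.toAlgHom K (MvPolynomial σ L) E).comp
    ((Algebra.ofId L (MvPolynomial σ L)).restrictScalars K), IsFractionRing.liftAlgHom hg,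
    fun z => rfl, fun f => ?_⟩
  rw [aeval_genericPoint, IsFractionRing.liftAlgHom_apply, IsFractionRing.lift_algebraMap]
  rfl

theorem sum_mul_grad_ne_zero {G : MvPolynomial σ K} [Fintype σ]
    (hind : LinearIndependent K fun i => pderiv i G)
    {φ ψ : FractionRing (MvPolynomial σ K) →ₐ[K]
        FractionRing (MvPolynomial σ (FractionRing (MvPolynomial σ K)))}
    (hφ : ∀ z, φ z = algebraMap _ _ (C z : MvPolynomial σ (FractionRing (MvPolynomial σ K))))
    (hψ : ∀ f : MvPolynomial σ K, ψ (aeval (genericPoint K σ) f) =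
        algebraMap _ _ (map (algebraMap K (FractionRing (MvPolynomial σ K))) f))
    (v : σ → FractionRing (MvPolynomial σ K)) (hv : v ≠ 0) :
    ∑ i, φ (v i) * ψ (grad (genericPoint K σ) G i) ≠ 0 := by
  intro h
  refine hv (funext fun i => (Module.forall_dual_apply_eq_zero_iff K (v i)).1 fun f => ?_)
  simp only [grad, hφ, hψ, ← map_mul, ← map_sum] at h
  have h0 := (IsFractionRing.injective (MvPolynomial σ (FractionRing (MvPolynomial σ K))) _)
    (h.trans (map_zero _).symm)
  refine Fintype.linearIndependent_iff.1 hind (fun i => f (v i)) ?_ i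
  ext m
  have hm := congrArg f (congrArg (coeff m) h0)
  simp only [coeff_sum, coeff_C_mul, coeff_map, map_sum, coeff_zero, map_zero] at hm
  rw [coeff_sum, coeff_zero, ← hm]
  refine Finset.sum_congr rfl fun i _ => ?_
  rw [coeff_smul, mul_comm (v i), ← Algebra.smul_def, map_smul, smul_eq_mul, smul_eq_mul, mul_comm]

/-- **Gordan–Noether**: in at most four variables, a form whose partial derivatives are linearly
independent has a nonzero Hessian determinant. -/
theorem det_hessian_ne_zero [CharZero K] [Fintype σ] [DecidableEq σ] [Nonempty σ]
    (hcard : Fintype.card σ ≤ 4) {G : MvPolynomial σ K} {d : ℕ} (hd : 2 ≤ d)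
    (hG : G.IsHomogeneous d) (hind : LinearIndependent K fun i => pderiv i G) :
    (Matrix.of fun i j => pderiv i (pderiv j G)).det ≠ 0 := by
  intro hdet
  obtain ⟨pd, hx, hcomm⟩ := exists_partial_derivatives (K := K) (σ := σ)
  obtain ⟨φ, ψ, hφ, hψ⟩ := exists_two_generic_points K σ
  have hsep := sum_mul_grad_ne_zero hind hφ hψ
  set L := FractionRing (MvPolynomial σ K)
  set x := genericPoint K σ with hxdef
  have : CharZero L := charZero_of_injective_algebraMap (algebraMap K L).injective
  have hG0 : aeval x G ≠ 0 := by
    rw [hxdef, aeval_genericPoint]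
    intro h
    obtain ⟨i⟩ := ‹Nonempty σ›
    have hG' : G = 0 := IsFractionRing.injective (MvPolynomial σ K) L (h.trans (map_zero _).symm)
    exact hind.ne_zero i (by simp [hG'])
  obtain ⟨v, hv0, hv⟩ : ∃ v ≠ 0, (Matrix.of (hess x G)).mulVec v = 0 := by
    rw [Matrix.exists_mulVec_eq_zero_iff]
    have := congrArg (algebraMap (MvPolynomial σ K) L) hdet
    rw [RingHom.map_det, map_zero] at this
    rw [← this]
    congr 1
    ext i j
    exact aeval_genericPoint _
  have hmem : ∀ w, w ∈ LinearMap.ker (Matrix.of (hess x G)).mulVecLin ↔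
      ∀ i, ∑ j, hess x G i j * w j = 0 := fun w => funext_iff
  obtain ⟨B, h, hW, hB, hspan⟩ :=
    exists_reduced_basis (LinearMap.ker (Matrix.of (hess x G)).mulVecLin)
  have hH : ∀ b i, ∑ j, hess x G i j * h b j = 0 := fun b => (hmem _).1 (hW b)
  have hne : B.Nonempty := by
    by_contra hB0
    rw [Finset.not_nonempty_iff_eq_empty] at hB0
    subst hB0
    exact hv0 ((hspan v hv).trans (by simp))
  have hflat : ∀ a b i, directional pd (h a) (h b i) = 0 := by
    intro a b
    refine congrFun ((hspan (fun i => directional pd (h a) (h b i))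
      ((hmem _).2 (hess_directional hx (hH a) (hH b)))).trans
      (Finset.sum_eq_zero fun c _ => ?_))
    rw [hB]
    split_ifs <;> simp
  by_cases hlt : Fintype.card σ < B.card + 3
  · exact false_of_large_corank hx hd hG hG0 hsep hH hB hflat hne hlt
  · have hone : B.card = 1 := by
      have := hne.card_pos
      omega
    obtain ⟨b, rfl⟩ := Finset.card_eq_one.1 hone
    set b' : ({b} : Finset σ) := ⟨b, Finset.mem_singleton_self b⟩
    refine false_of_corank_one hx hcomm hd hG hG0 hsep (hH b') (b := b)
      (by simpa using hB b' b') (fun w hw hwb => (hspan w ((hmem w).2 hw)).trans ?_) hcard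
    refine Finset.sum_eq_zero fun c _ => ?_
    rw [Finset.mem_singleton.1 c.2, hwb, zero_smul]

end FunctionField

section Lefschetz

variable {K σ : Type*} [Field K] [Fintype σ]

/-- The constant coefficient operator `∑ i, k i ∂ᵢ`. -/
noncomputable def linearOperator (k : σ → K) : Module.End K (MvPolynomial σ K) :=
  ∑ i, k i • (pderiv i).toLinearMap

theorem linearOperator_apply (k : σ → K) (f : MvPolynomial σ K) :
    linearOperator k f = ∑ i, k i • pderiv i f := by
  simp only [linearOperator, LinearMap.sum_apply, LinearMap.smul_apply]
  rfl

theorem pderiv_linearOperator (k : σ → K) (j : σ) (f : MvPolynomial σ K) :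
    pderiv j (linearOperator k f) = linearOperator k (pderiv j f) := by
  simp only [linearOperator_apply, map_sum, Derivation.map_smul, pderiv_comm j]

theorem pderiv_linearOperator_pow (k : σ → K) (j : σ) (e : ℕ) (f : MvPolynomial σ K) :
    pderiv j ((linearOperator k ^ e) f) = (linearOperator k ^ e) (pderiv j f) := by
  induction e generalizing f with
  | zero => simp
  | succ e ih =>
    rw [pow_succ, Module.End.mul_apply, ih, pderiv_linearOperator, Module.End.mul_apply]

/-- `(∑ kᵢ ∂ᵢ) ^ e` sends a form of degree `e` to `e!` times its value at `k`. -/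
theorem linearOperator_pow_of_isHomogeneous (k : σ → K) {e : ℕ} {f : MvPolynomial σ K}
    (hf : f.IsHomogeneous e) : (linearOperator k ^ e) f = C (e.factorial * eval k f) := by
  induction e generalizing f with
  | zero =>
    rw [totalDegree_eq_zero_iff_eq_C.1 (Nat.le_zero.1 hf.totalDegree_le)]
    simp
  | succ e ih =>
    have h : ∀ i, (linearOperator k ^ e) (pderiv i f) = C (e.factorial * eval k (pderiv i f)) :=
      fun i => ih hf.pderiv
    have hE := congrArg (eval k) hf.sum_X_mul_pderiv
    rw [pow_succ, Module.End.mul_apply, linearOperator_apply, map_sum]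
    simp only [map_smul, h]
    simp only [smul_eq_C_mul, ← C_mul, ← map_sum]
    congr 1
    simp only [map_sum, map_mul, eval_X, nsmul_eq_mul, map_natCast] at hE
    rw [Nat.factorial_succ, Nat.cast_mul, mul_comm ((e + 1 : ℕ) : K), mul_assoc, ← hE,
      Finset.mul_sum]
    exact Finset.sum_congr rfl fun i _ => by ring

theorem exists_linearOperator_lefschetz [CharZero K] [Nonempty σ] (hcard : Fintype.card σ ≤ 4)
    {G : MvPolynomial σ K} {d : ℕ} (hd : 2 ≤ d) (hG : G.IsHomogeneous d)
    (hind : LinearIndependent K fun i => pderiv i G) :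
    ∃ k : σ → K, ∀ c : σ → K,
      (linearOperator k ^ (d - 2) * linearOperator c) G = 0 → linearOperator c G = 0 := by
  classical
  have hdet := det_hessian_ne_zero hcard hd hG hind
  obtain ⟨k, hk⟩ : ∃ k : σ → K, eval k (Matrix.of fun i j => pderiv i (pderiv j G)).det ≠ 0 := by
    by_contra! h
    exact hdet (MvPolynomial.funext fun k => by rw [h, map_zero])
  refine ⟨k, fun c hc => ?_⟩
  have hmul : (Matrix.of fun i j => eval k (pderiv i (pderiv j G))).mulVec c = 0 := by
    funext j
    have h1 := congrArg (pderiv j) hc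
    rw [Module.End.mul_apply, pderiv_linearOperator_pow, pderiv_linearOperator, map_zero,
      linearOperator_apply, map_sum] at h1
    have h2 : ∀ i, (linearOperator k ^ (d - 2)) (pderiv i (pderiv j G)) =
        C ((d - 2).factorial * eval k (pderiv i (pderiv j G))) := fun i =>
      linearOperator_pow_of_isHomogeneous k hG.pderiv.pderiv
    simp only [map_smul, h2] at h1
    simp only [smul_eq_C_mul, ← C_mul, ← map_sum, C_eq_zero] at h1
    refine (mul_eq_zero.1 ?_).resolve_left
      (Nat.cast_ne_zero.2 (d - 2).factorial_ne_zero : ((d - 2).factorial : K) ≠ 0)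
    rw [← h1, Matrix.mulVec, dotProduct, Finset.mul_sum]
    exact Finset.sum_congr rfl fun i _ => by
      rw [Matrix.of_apply, pderiv_comm j i]; ring
  have hc0 : c = 0 := by
    refine Matrix.eq_zero_of_mulVec_eq_zero ?_ hmul
    rwa [RingHom.map_det] at hk
  rw [linearOperator_apply, hc0]
  simp

end Lefschetz

end GordanNoether


/-- **Gordan–Noether via differential operators.** Let `G` be homogeneous of degree `d ≥ 2`
in `n + 1 ≤ 4` variables over an algebraically closed field of characteristic `0`, with
linearly independent first partial derivatives.  Then there is a first order constant
coefficient operator `L = Σ kᵢ ∂ᵢ` such that for every first order operator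
`y = Σ cᵢ ∂ᵢ`, `(L^(d-2) · y)(G) = 0` implies `y(G) = 0`
(strong Lefschetz in degree `1` for `Q / Ann_Q(G)`). -/
theorem slp_degree_one_apolar_of_dim_le_three
    {K : Type*} [Field K] [IsAlgClosed K] [CharZero K]
    {n : ℕ} (hn : n ≤ 3) {d : ℕ} (hd : 2 ≤ d)
    {G : MvPolynomial (Fin (n + 1)) K} (hG : G.IsHomogeneous d)
    (hind : LinearIndependent K (fun i : Fin (n + 1) => MvPolynomial.pderiv i G)) :
    ∃ k : Fin (n + 1) → K,
      ∀ c : Fin (n + 1) → K,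
        ((((∑ i, k i • (MvPolynomial.pderiv i).toLinearMap :
              Module.End K (MvPolynomial (Fin (n + 1)) K)) ^ (d - 2) *
            (∑ i, c i • (MvPolynomial.pderiv i).toLinearMap) :
              Module.End K (MvPolynomial (Fin (n + 1)) K)) :
            MvPolynomial (Fin (n + 1)) K →ₗ[K] MvPolynomial (Fin (n + 1)) K) G = 0 →
        ((∑ i, c i • (MvPolynomial.pderiv i).toLinearMap :
            Module.End K (MvPolynomial (Fin (n + 1)) K)) :
            MvPolynomial (Fin (n + 1)) K →ₗ[K] MvPolynomial (Fin (n + 1)) K) G = 0) := by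
  obtain ⟨k, hk⟩ := GordanNoether.exists_linearOperator_lefschetz
    (by rw [Fintype.card_fin]; omega) hd hG hind
  exact ⟨k, hk⟩
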